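/- For every positive integer a, there is no distinct covering system whose least modulus is 5 and whose moduli have least common multiple equal to 2^a·3·5. -/

import Mathlib

open Finset

/-- Among `n * q` consecutive integers exactly `q` lie in a given residue class mod `n`. -/
theorem card_filter_modEq_Ico (n q : ℕ) (hn : 0 < n) (v : ℤ) :
    #{x ∈ Ico (0 : ℤ) (n * q : ℕ) | x ≡ v [ZMOD n]} = q := by
  have h := Int.Ico_filter_modEq_card (0 : ℤ) (n * q : ℕ) (r := (n : ℤ)) (by exact_mod_cast hn) v
  have hn' : (n : ℚ) ≠ 0 := by positivity
  have e : (((n * q : ℕ) : ℤ) - v : ℚ) / ((n : ℤ) : ℚ)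
      = (((0 : ℤ) : ℚ) - v) / ((n : ℤ) : ℚ) + (q : ℤ) := by
    push_cast
    field_simp
    ring
  rw [e, Int.ceil_add_intCast, add_sub_cancel_left, max_eq_left (by positivity)] at h
  exact_mod_cast h

/-- Among `n * (p * q)` consecutive integers, a residue class mod `n` with a residue class mod
a coprime `p` removed has at most `(p - 1) * q` elements. -/
theorem card_filter_modEq_not_modEq_add_le (n p q : ℕ) (hn : 0 < n) (hp : 0 < p)
    (hnp : n.Coprime p) (v s : ℤ) :
    #{x ∈ Ico (0 : ℤ) (n * (p * q) : ℕ) | ¬ x ≡ s [ZMOD p] ∧ x ≡ v [ZMOD n]} + q ≤ p * q := by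
  have hcop : IsCoprime (n : ℤ) p := Nat.isCoprime_iff_coprime.2 hnp
  obtain ⟨α, β, hαβ⟩ := hcop
  set z : ℤ := s * (α * n) + v * (β * p)
  have hzn : z ≡ v [ZMOD n] := (Int.modEq_iff_dvd.2 ⟨(v - s) * α, by grind⟩)
  have hzp : z ≡ s [ZMOD p] := (Int.modEq_iff_dvd.2 ⟨(s - v) * β, by grind⟩)
  have h1 := card_filter_modEq_Ico n (p * q) hn v
  have h2 := card_filter_modEq_Ico (n * p) q (by positivity) z
  rw [mul_assoc] at h2
  have hd : Disjoint
      {x ∈ Ico (0 : ℤ) (n * (p * q) : ℕ) | ¬ x ≡ s [ZMOD p] ∧ x ≡ v [ZMOD n]}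
      {x ∈ Ico (0 : ℤ) (n * (p * q) : ℕ) | x ≡ z [ZMOD (n * p : ℕ)]} := by
    rw [disjoint_filter]
    rintro x - ⟨hx, -⟩ hxz
    push_cast at hxz
    exact hx ((hxz.of_mul_left _).trans hzp)
  have hle := card_le_card (union_subset
    (monotone_filter_right (Ico (0 : ℤ) (n * (p * q) : ℕ))
      (p := fun x ↦ ¬ x ≡ s [ZMOD p] ∧ x ≡ v [ZMOD n]) (q := fun x ↦ x ≡ v [ZMOD n])
      fun x _ hx ↦ hx.2)
    (monotone_filter_right (Ico (0 : ℤ) (n * (p * q) : ℕ))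
      (p := fun x ↦ x ≡ z [ZMOD (n * p : ℕ)]) (q := fun x ↦ x ≡ v [ZMOD n])
      fun x _ hx ↦ by
        push_cast at hx
        exact (hx.of_mul_right _).trans hzn))
  rw [card_union_of_disjoint hd] at hle
  omega

/-- A divisor of `2 ^ a * 15` that exceeds `5` lies in one of four families. -/
theorem eq_of_dvd_two_pow_mul_fifteen {a n : ℕ} (h : n ∣ 2 ^ a * 15) (hn : 5 < n) :
    (∃ k ∈ Icc 3 a, n = 2 ^ k) ∨ (∃ k ∈ Icc 1 a, n = 2 ^ k * 3) ∨
      (∃ k ∈ Icc 1 a, n = 2 ^ k * 5) ∨ ∃ k ∈ Icc 0 a, n = 2 ^ k * 15 := by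
  obtain ⟨y, z, hy, hz, rfl⟩ := (Nat.dvd_mul).1 h
  obtain ⟨k, hk, rfl⟩ := (Nat.dvd_prime_pow Nat.prime_two).1 hy
  have hz' : z ∈ Nat.divisors 15 := Nat.mem_divisors.2 ⟨hz, by norm_num⟩
  rw [show Nat.divisors 15 = {1, 3, 5, 15} by decide] at hz'
  simp only [mem_insert, mem_singleton] at hz'
  have hsmall : ∀ m, k ≤ m → 2 ^ k ≤ 2 ^ m := fun m hm ↦ Nat.pow_le_pow_right two_pos hm
  rcases hz' with rfl | rfl | rfl | rfl
  · refine .inl ⟨k, mem_Icc.2 ⟨?_, hk⟩, by simp⟩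
    by_contra hlt
    have := hsmall 2 (by omega)
    omega
  · refine .inr (.inl ⟨k, mem_Icc.2 ⟨?_, hk⟩, rfl⟩)
    by_contra hlt
    have := hsmall 0 (by omega)
    omega
  · refine .inr (.inr (.inl ⟨k, mem_Icc.2 ⟨?_, hk⟩, rfl⟩))
    by_contra hlt
    have := hsmall 0 (by omega)
    omega
  · exact .inr (.inr (.inr ⟨k, mem_Icc.2 ⟨k.zero_le, hk⟩, rfl⟩))

theorem two_pow_mul_sum_Icc_two_pow_sub_lt (a b : ℕ) :
    2 ^ b * ∑ k ∈ Icc b a, 2 ^ (a - k) < 2 ^ (a + 1) := by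
  rcases lt_or_ge a b with hab | hab
  · simp [Icc_eq_empty_of_lt hab]
  · have hs : ∑ k ∈ Icc b a, 2 ^ (a - k) = ∑ j ∈ range (a - b + 1), 2 ^ j := by
      refine sum_nbij' (fun k ↦ a - k) (fun j ↦ a - j) ?_ ?_ ?_ ?_ ?_ <;>
        intro k hk <;> simp only [mem_Icc, mem_range] at * <;> omega
    have hlt : ∑ j ∈ range (a - b + 1), 2 ^ j < 2 ^ (a - b + 1) :=
      Nat.geomSum_lt le_rfl fun j hj ↦ mem_range.1 hj
    calc 2 ^ b * ∑ k ∈ Icc b a, 2 ^ (a - k) < 2 ^ b * 2 ^ (a - b + 1) := by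
          rw [hs]
          gcongr
      _ = 2 ^ (a + 1) := by
          rw [← pow_add]
          congr 1
          omega

/-- For every positive integer `a`, there is no distinct covering system whose
least modulus is `5` and whose moduli have least common multiple `2^a * 3 * 5`. -/
theorem no_covering_m5_lcm_pow2_3_5 (a : ℕ) (ha : 1 ≤ a) :
    ¬ ∃ (S : Finset ℕ) (r : ℕ → ℤ),
        (∀ n ∈ S, 1 < n) ∧
        (∀ x : ℤ, ∃ n ∈ S, x ≡ r n [ZMOD (n : ℤ)]) ∧
        (5 ∈ S ∧ ∀ n ∈ S, 5 ≤ n) ∧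
        S.lcm id = 2 ^ a * 3 * 5 := by
  rintro ⟨S, r, -, hcov, ⟨-, hmin⟩, hlcm⟩
  -- Outside the class mod `5` there remain `12 * 2 ^ a` integers mod `2 ^ a * 15`.
  set I : Finset ℤ := Ico (0 : ℤ) (2 ^ a * 15 : ℕ) with hI
  set T : Finset ℤ := {x ∈ I | ¬ x ≡ r 5 [ZMOD (5 : ℕ)]}
  set B : ℕ → Finset ℤ := fun n ↦ {x ∈ I | ¬ x ≡ r 5 [ZMOD (5 : ℕ)] ∧ x ≡ r n [ZMOD n]}
  have hTcard : #T = 12 * 2 ^ a := by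
    have h1 := card_filter_modEq_Ico 5 (3 * 2 ^ a) (by norm_num) (r 5)
    rw [show 5 * (3 * 2 ^ a) = 2 ^ a * 15 by ring, ← hI] at h1
    have h2 := card_filter_add_card_filter_not (s := I) (fun x ↦ x ≡ r 5 [ZMOD (5 : ℕ)])
    have h3 : #I = 2 ^ a * 15 := by rw [hI, Int.card_Ico, sub_zero, Int.toNat_natCast]
    change _ + #T = _ at h2
    omega
  have hsplit : ∀ k ≤ a, 2 ^ a = 2 ^ k * 2 ^ (a - k) := fun k hk ↦ by
    rw [← pow_add, Nat.add_sub_cancel' hk]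
  have hcard : ∀ n q, 0 < n → n * q = 2 ^ a * 15 → #(B n) ≤ q := fun n q hn hq ↦ by
    rw [← card_filter_modEq_Ico n q hn (r n), hq]
    exact card_le_card (monotone_filter_right _ fun x _ hx ↦ hx.2)
  have hcard' : ∀ n q, 0 < n → n.Coprime 5 → n * (5 * q) = 2 ^ a * 15 → #(B n) ≤ 4 * q :=
    fun n q hn hn5 hq ↦ by
      have := card_filter_modEq_not_modEq_add_le n 5 q hn (by norm_num) hn5 (r n) (r 5)
      rw [hq] at this
      change #(B n) + q ≤ 5 * q at this
      omega
  have hcop : ∀ k, (2 ^ k).Coprime 5 := fun k ↦ Nat.Coprime.pow_left k (by norm_num)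
  have hfam : ∀ b c d : ℕ, (∀ k ∈ Icc b a, #(B (2 ^ k * d)) ≤ c * 2 ^ (a - k)) →
      #((Icc b a).biUnion fun k ↦ B (2 ^ k * d)) ≤ c * ∑ k ∈ Icc b a, 2 ^ (a - k) :=
    fun b c d h ↦ by
      rw [mul_sum]
      exact card_biUnion_le.trans (sum_le_sum h)
  have h1 := hfam 3 12 1 fun k hk ↦ by
    have := hcard' (2 ^ k * 1) (3 * 2 ^ (a - k)) (by positivity) (by simpa using hcop k)
      (by rw [hsplit k (mem_Icc.1 hk).2]; ring)
    omega
  have h3 := hfam 1 4 3 fun k hk ↦ hcard' (2 ^ k * 3) (2 ^ (a - k)) (by positivity)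
    ((hcop k).mul_left (by norm_num)) (by rw [hsplit k (mem_Icc.1 hk).2]; ring)
  have h5 := hfam 1 3 5 fun k hk ↦ hcard (2 ^ k * 5) (3 * 2 ^ (a - k)) (by positivity)
    (by rw [hsplit k (mem_Icc.1 hk).2]; ring)
  have h15 := hfam 0 1 15 fun k hk ↦ hcard (2 ^ k * 15) (1 * 2 ^ (a - k)) (by positivity)
    (by rw [hsplit k (mem_Icc.1 hk).2]; ring)
  have hsub : T ⊆ (((Icc 3 a).biUnion fun k ↦ B (2 ^ k * 1)) ∪
      ((Icc 1 a).biUnion fun k ↦ B (2 ^ k * 3))) ∪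
      (((Icc 1 a).biUnion fun k ↦ B (2 ^ k * 5)) ∪
      ((Icc 0 a).biUnion fun k ↦ B (2 ^ k * 15))) := by
    intro x hx
    obtain ⟨hxI, hx5⟩ := mem_filter.1 hx
    obtain ⟨n, hnS, hxn⟩ := hcov x
    have hxB : x ∈ B n := mem_filter.2 ⟨hxI, hx5, hxn⟩
    have hn5 : n ≠ 5 := by
      rintro rfl
      exact hx5 hxn
    have hdvd : n ∣ 2 ^ a * 15 := by
      have := dvd_lcm (f := id) hnS
      rwa [hlcm, mul_assoc] at this
    simp only [mem_union, mem_biUnion]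
    rcases eq_of_dvd_two_pow_mul_fifteen hdvd (lt_of_le_of_ne (hmin n hnS) hn5.symm) with
      ⟨k, hk, rfl⟩ | ⟨k, hk, rfl⟩ | ⟨k, hk, rfl⟩ | ⟨k, hk, rfl⟩
    · exact .inl (.inl ⟨k, hk, by rwa [mul_one]⟩)
    · exact .inl (.inr ⟨k, hk, hxB⟩)
    · exact .inr (.inl ⟨k, hk, hxB⟩)
    · exact .inr (.inr ⟨k, hk, hxB⟩)
  have hle := (card_le_card hsub).trans ((card_union_le _ _).trans
    (add_le_add (card_union_le _ _) (card_union_le _ _)))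
  have s3 := two_pow_mul_sum_Icc_two_pow_sub_lt a 3
  have s1 := two_pow_mul_sum_Icc_two_pow_sub_lt a 1
  have s0 := two_pow_mul_sum_Icc_two_pow_sub_lt a 0
  rw [pow_succ] at s3 s1 s0
  omega
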